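/- Let $(p_n)$ be a sequence of positive reals with $P_n = p_0 + \cdots + p_n$ and conventions $P_{-1} = p_{-1} = 0$. Let $(a_n)$ be a complex sequence with partial sums $s_n = a_0 + \cdots + a_n$, and set $T_{-1,n}(s) = s_{n-1}$ and $T_{m,n}(s) = \frac{1}{P_m} \sum_{v=0}^m p_v s_{n+v}$ for $m \geq 0$. Then for all $m, n \geq 0$: $T_{m,n}(s) - T_{m-1,n}(s) = a_n$ when $m = 0$, and $T_{m,n}(s) - T_{m-1,n}(s) = \frac{p_m}{P_m P_{m-1}} \sum_{v=1}^m P_{v-1} a_{n+v}$ when $m \geq 1$. -/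

import Mathlib

open Filter

noncomputable section

/-- `PS p n = p 0 + ⋯ + p (n-1)`; this is the paper's `P_{n-1}`, so that
`PS p 0 = P_{-1} = 0` and `PS p (n+1) = P_n`. -/
def PS (p : ℕ → ℝ) (n : ℕ) : ℝ := ∑ i ∈ Finset.range n, p i

/-- `Fmn p a m n` is the paper's `F_{m,n}(a)`: `a n` for `m = 0`, and
`(p m / (P_m P_{m-1})) ∑_{v=1}^m P_{v-1} a_{n+v}` for `m ≥ 1`. -/
def Fmn (p : ℕ → ℝ) (a : ℕ → ℂ) (m n : ℕ) : ℂ :=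
  if m = 0 then a n
  else ((p m / (PS p (m + 1) * PS p m) : ℝ) : ℂ) *
      ∑ v ∈ Finset.Icc 1 m, ((PS p v : ℝ) : ℂ) * a (n + v)

/-- The weighted mean transform `T_{m,n}(s) = (1/P_m) ∑_{v=0}^m p_v s_{n+v}`. -/
def Tmn (p : ℕ → ℝ) (s : ℕ → ℂ) (m n : ℕ) : ℂ :=
  ((1 / PS p (m + 1) : ℝ) : ℂ) * ∑ v ∈ Finset.range (m + 1), ((p v : ℝ) : ℂ) * s (n + v)

theorem PS_succ (p : ℕ → ℝ) (n : ℕ) : PS p (n + 1) = PS p n + p n :=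
  Finset.sum_range_succ p n

theorem PS_pos {p : ℕ → ℝ} (hp : ∀ n, 0 < p n) {n : ℕ} (hn : n ≠ 0) : 0 < PS p n :=
  Finset.sum_pos (fun i _ => hp i) (Finset.nonempty_range_iff.mpr hn)

/-- Summation by parts: `PS p` has increments `p` and `s` has increments `a`. -/
theorem sum_Icc_PS_mul (p : ℕ → ℝ) {a s : ℕ → ℂ} (hs : ∀ n, s (n + 1) = s n + a (n + 1))
    (m n : ℕ) :
    ∑ v ∈ Finset.Icc 1 m, ((PS p v : ℝ) : ℂ) * a (n + v) =
      ((PS p m : ℝ) : ℂ) * s (n + m) -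
        ∑ v ∈ Finset.range m, ((p v : ℝ) : ℂ) * s (n + v) := by
  induction m with
  | zero => simp [PS]
  | succ m ih =>
    rw [Finset.sum_Icc_succ_top (by omega), ih, Finset.sum_range_succ, PS_succ, ← add_assoc n,
      hs (n + m)]
    push_cast
    ring

/-- The identity `F_{m,n}(a) = T_{m,n}(s) - T_{m-1,n}(s)`, where `s` is the
sequence of partial sums of `a` (and `T_{-1,n}(s) = s_{n-1}`). -/
theorem stmt15 (p : ℕ → ℝ) (hp : ∀ n, 0 < p n) (a s : ℕ → ℂ)
    (hs : ∀ n, s n = ∑ j ∈ Finset.range (n + 1), a j) :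
    (∀ n, Tmn p s 0 n - ∑ j ∈ Finset.range n, a j = a n) ∧
      (∀ m, 1 ≤ m → ∀ n, Tmn p s m n - Tmn p s (m - 1) n =
        ((p m / (PS p (m + 1) * PS p m) : ℝ) : ℂ) *
          ∑ v ∈ Finset.Icc 1 m, ((PS p v : ℝ) : ℂ) * a (n + v)) := by
  refine ⟨fun n => ?_, fun m hm n => ?_⟩
  · have h0 : (p 0 : ℂ) ≠ 0 := Complex.ofReal_ne_zero.mpr (hp 0).ne'
    simp [Tmn, PS, hs, Finset.sum_range_succ, h0]
  · obtain ⟨k, rfl⟩ := Nat.exists_eq_add_of_le' hm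
    have hs' : ∀ n, s (n + 1) = s n + a (n + 1) := fun n => by
      rw [hs, hs, Finset.sum_range_succ]
    have h1 : (PS p (k + 1) : ℂ) ≠ 0 :=
      Complex.ofReal_ne_zero.mpr (PS_pos hp k.succ_ne_zero).ne'
    have h2 : (PS p (k + 1) : ℂ) + p (k + 1) ≠ 0 := by
      rw [← Complex.ofReal_add, ← PS_succ]
      exact Complex.ofReal_ne_zero.mpr (PS_pos hp (k + 1).succ_ne_zero).ne'
    rw [sum_Icc_PS_mul p hs', Nat.add_sub_cancel, Tmn, Tmn,
      Finset.sum_range_succ _ (k + 1), PS_succ p (k + 1)]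
    push_cast
    field_simp
    ring
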